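/- There is no PL K₃,₃-configuration in the plane: one cannot choose two disjoint three-element sets U, V ⊆ ℝ² together with nine piecewise-linear arcs f_{u,v} (u ∈ U, v ∈ V), each joining u to v, such that the open interiors f_{u,v}⁰ are pairwise disjoint and disjoint from U ∪ V. -/

import Mathlib

/-- A PL map on `[a,b]`: affine and nonconstant on each piece of a finite
partition of `[a,b]`. -/
def IsPLMap (f : ℝ → ℝ × ℝ) (a b : ℝ) : Prop :=
  ∃ (k : ℕ) (t : ℕ → ℝ), 0 < k ∧ t 0 = a ∧ t k = b ∧
    (∀ i < k, t i < t (i + 1)) ∧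
    ∀ i < k, ∃ u v : ℝ × ℝ, v ≠ 0 ∧
      ∀ x ∈ Set.Icc (t i) (t (i + 1)), f x = u + x • v

/-- A PL arc on `[0,1]`: an injective PL map. -/
def IsPLArc01 (f : ℝ → ℝ × ℝ) : Prop :=
  IsPLMap f 0 1 ∧ Set.InjOn f (Set.Icc (0 : ℝ) 1)

open Complex in
/-- A nonvanishing continuous function on a suitable space has a continuous logarithm. -/
lemma exists_log_plane (g : ℝ × ℝ → ℂ) (hg : Continuous g) (h0 : ∀ x, g x ≠ 0) :
    ∃ L : ℝ × ℝ → ℂ, Continuous L ∧ ∀ x, exp (L x) = g x := by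
  have hs : IsSimplyConnected (Set.univ : Set (ℝ × ℝ)) := by
    have := (convex_univ (𝕜 := ℝ) (E := ℝ × ℝ)).contractibleSpace Set.univ_nonempty
    exact SimplyConnectedSpace.ofContractible _
  obtain ⟨f, hf, hfe⟩ := exists_continuousOn_eqOn_exp_comp hs isOpen_univ hg.continuousOn
    (by rintro ⟨x, -, hx⟩; exact h0 x hx)
  exact ⟨f, continuousOn_univ.1 hf, fun x => hfe (Set.mem_univ x)⟩

open Classical in
/-- Increment over `[0,1]` of a continuous logarithm of `g`. -/
noncomputable def logInc (g : ℝ → ℂ) : ℂ :=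
  if h : ∃ L : ℝ → ℂ, Continuous L ∧ ∀ x, Complex.exp (L x) = g x then
    h.choose 1 - h.choose 0 else 0

lemma logInc_eq {g L : ℝ → ℂ} (hL : Continuous L) (he : ∀ x, Complex.exp (L x) = g x) :
    logInc g = L 1 - L 0 := by
  have h : ∃ L : ℝ → ℂ, Continuous L ∧ ∀ x, Complex.exp (L x) = g x := ⟨L, hL, he⟩
  rw [logInc, dif_pos h]
  obtain ⟨hc, hce⟩ := h.choose_spec
  set M := h.choose
  have key := Complex.isCoveringMap_exp.const_of_comp (g := fun x => M x - L x)
    (hc.sub hL) (fun a a' => by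
      apply Subtype.ext
      simp [Complex.exp_sub, he, hce]
      have h1 : g a ≠ 0 := by rw [← he]; exact Complex.exp_ne_zero _
      have h2 : g a' ≠ 0 := by rw [← he]; exact Complex.exp_ne_zero _
      rw [div_self h1, div_self h2]) 1 0
  linear_combination key

lemma logInc_neg_eq {g L : ℝ → ℂ} (hL : Continuous L) (he : ∀ x, Complex.exp (L x) = - g x) :
    logInc g = L 1 - L 0 := by
  have := logInc_eq (g := g) (L := fun x => L x + Real.pi * Complex.I) (by fun_prop)
    (fun x => by simp [Complex.exp_add, he])
  rw [this]; ring

lemma exp_logInc {g : ℝ → ℂ} (hg : Continuous g) (h0 : ∀ x, g x ≠ 0) :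
    Complex.exp (logInc g) = g 1 / g 0 := by
  obtain ⟨L, hL, he⟩ := exists_log_plane (fun x => g x.1) (by fun_prop) (fun x => h0 _)
  rw [logInc_eq (L := fun t => L (t, 0)) (by fun_prop) (fun x => he (x, 0)), Complex.exp_sub,
    he, he]

/-- The boundary relation of the square `[0,1]²` mapped by two disjoint arcs. -/
lemma square_rel {e f : ℝ → ℂ} (he : Continuous e) (hf : Continuous f)
    (hd : ∀ s t, e s ≠ f t) :
    logInc (fun t => e 0 - f t) - logInc (fun t => e 1 - f t) =
      logInc (fun s => f 0 - e s) - logInc (fun s => f 1 - e s) := by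
  obtain ⟨L, hL, hLe⟩ := exists_log_plane (fun x => e x.1 - f x.2) (by fun_prop)
    (fun x => sub_ne_zero.2 (hd _ _))
  rw [logInc_eq (L := fun t => L (0, t)) (by fun_prop) (fun t => hLe (0, t)),
    logInc_eq (L := fun t => L (1, t)) (by fun_prop) (fun t => hLe (1, t)),
    logInc_neg_eq (L := fun t => L (t, 0)) (by fun_prop) (fun t => by rw [hLe]; simp),
    logInc_neg_eq (L := fun t => L (t, 1)) (by fun_prop) (fun t => by rw [hLe]; simp)]
  ring

/-- The topological core: no continuous drawing of `K₃,₃` in which independent edges are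
disjoint. -/
lemma no_cont_K33 (p q : Fin 3 → ℂ) (γ : Fin 3 → Fin 3 → ℝ → ℂ)
    (hc : ∀ i j, Continuous (γ i j)) (h0 : ∀ i j, γ i j 0 = p i) (h1 : ∀ i j, γ i j 1 = q j)
    (hd : ∀ i j k l, i ≠ k → j ≠ l → ∀ s t, γ i j s ≠ γ k l t) : False := by
  obtain ⟨a, ha⟩ : ∃ a : Fin 3 → Fin 3 → Fin 3 → ℂ,
      ∀ i k l, a i k l = logInc (fun t => p i - γ k l t) := ⟨_, fun _ _ _ => rfl⟩
  obtain ⟨b, hb⟩ : ∃ b : Fin 3 → Fin 3 → Fin 3 → ℂ,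
      ∀ j k l, b j k l = logInc (fun t => q j - γ k l t) := ⟨_, fun _ _ _ => rfl⟩
  have R : ∀ i j k l, i ≠ k → j ≠ l → a i k l - b j k l = a k i j - b l i j := by
    intro i j k l hik hjl
    have := square_rel (hc i j) (hc k l) (hd i j k l hik hjl)
    simpa only [h0, h1, ← ha, ← hb] using this
  have ex : ∀ l : Fin 3, ∃ j, j ≠ l := by decide
  have pne : ∀ i k l, i ≠ k → ∀ t, p i - γ k l t ≠ 0 := by
    intro i k l hik t
    obtain ⟨j, hj⟩ := ex l
    have := hd i j k l hik hj 0 t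
    rw [h0] at this
    exact sub_ne_zero.2 this
  have qne : ∀ j k l, j ≠ l → ∀ t, q j - γ k l t ≠ 0 := by
    intro j k l hjl t
    obtain ⟨i, hi⟩ := ex k
    have := hd i j k l hi hjl 1 t
    rw [h1] at this
    exact sub_ne_zero.2 this
  have pp : ∀ i k, i ≠ k → p i - p k ≠ 0 := fun i k h => by
    have := pne i k 0 h 0; rwa [h0] at this
  have qq : ∀ i k, i ≠ k → q i - q k ≠ 0 := fun i k h => by
    have := qne i 0 k h 1; rwa [h1] at this
  have pq : ∀ i l, p i - q l ≠ 0 := fun i l => by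
    obtain ⟨k, hk⟩ := ex i
    have := pne i k l hk.symm 1; rwa [h1] at this
  have A : ∀ i k l, i ≠ k → Complex.exp (a i k l) = (p i - q l) / (p i - p k) := by
    intro i k l h
    have hk := hc k l
    rw [ha, exp_logInc (by fun_prop) (pne i k l h), h0, h1]
  have B : ∀ j k l, j ≠ l → Complex.exp (b j k l) = (q j - q l) / (q j - p k) := by
    intro j k l h
    have hk := hc k l
    rw [hb, exp_logInc (by fun_prop) (qne j k l h), h0, h1]
  have A' : ∀ i k l, i ≠ k →
      Complex.exp (a i k l - a k i l) = -((p i - q l) / (p k - q l)) := by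
    intro i k l h
    have e1 := pp i k h
    have e2 := pp k i h.symm
    have e3 := pq i l
    have e4 := pq k l
    rw [Complex.exp_sub, A i k l h, A k i l h.symm]
    have : p k - p i = -(p i - p k) := by ring
    rw [this]
    field_simp
  have B' : ∀ j l, j ≠ l →
      Complex.exp (b j 0 l - b j 2 l) = (p 2 - q j) / (p 0 - q j) := by
    intro j l h
    have e1 := qq j l h
    have e3 := pq 0 j
    have e4 := pq 2 j
    rw [Complex.exp_sub, B j 0 l h, B j 2 l h]
    have t1 : q j - p 0 = -(p 0 - q j) := by ring
    have t2 : q j - p 2 = -(p 2 - q j) := by ring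
    rw [t1, t2]
    field_simp
  have X : (a 0 1 0 - a 1 0 0) + (a 0 1 1 - a 1 0 1) + (a 0 1 2 - a 1 0 2) +
      (a 0 2 0 - a 2 0 0) + (a 0 2 1 - a 2 0 1) + (a 0 2 2 - a 2 0 2) +
      (a 1 2 0 - a 2 1 0) + (a 1 2 1 - a 2 1 1) + (a 1 2 2 - a 2 1 2) +
      (b 0 0 1 - b 0 2 1) + (b 0 0 2 - b 0 2 2) + (b 1 0 0 - b 1 2 0) +
      (b 1 0 2 - b 1 2 2) + (b 2 0 0 - b 2 2 0) + (b 2 0 1 - b 2 2 1) = 0 := by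
    have S : ∀ i k : Fin 3, i ≠ k →
        2 * ((a i k 0 - a k i 0) + (a i k 1 - a k i 1) + (a i k 2 - a k i 2)) +
        ((b 0 i 1 - b 0 k 1) + (b 0 i 2 - b 0 k 2) + (b 1 i 0 - b 1 k 0) +
        (b 1 i 2 - b 1 k 2) + (b 2 i 0 - b 2 k 0) + (b 2 i 1 - b 2 k 1)) = 0 := by
      intro i k h
      linear_combination R i 0 k 1 h (by decide) + R i 0 k 2 h (by decide) +
        R i 1 k 0 h (by decide) + R i 1 k 2 h (by decide) + R i 2 k 0 h (by decide) +
        R i 2 k 1 h (by decide)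
    linear_combination (S 0 1 (by decide) + S 0 2 (by decide) + S 1 2 (by decide)) / 2
  have Y := congrArg Complex.exp X
  simp only [Complex.exp_add, Complex.exp_zero] at Y
  rw [A' 0 1 0 (by decide), A' 0 1 1 (by decide), A' 0 1 2 (by decide),
    A' 0 2 0 (by decide), A' 0 2 1 (by decide), A' 0 2 2 (by decide),
    A' 1 2 0 (by decide), A' 1 2 1 (by decide), A' 1 2 2 (by decide),
    B' 0 1 (by decide), B' 0 2 (by decide), B' 1 0 (by decide),
    B' 1 2 (by decide), B' 2 0 (by decide), B' 2 1 (by decide)] at Y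
  have z00 := pq 0 0
  have z01 := pq 0 1
  have z02 := pq 0 2
  have z10 := pq 1 0
  have z11 := pq 1 1
  have z12 := pq 1 2
  have z20 := pq 2 0
  have z21 := pq 2 1
  have z22 := pq 2 2
  generalize p 0 - q 0 = x00 at *
  generalize p 0 - q 1 = x01 at *
  generalize p 0 - q 2 = x02 at *
  generalize p 1 - q 0 = x10 at *
  generalize p 1 - q 1 = x11 at *
  generalize p 1 - q 2 = x12 at *
  generalize p 2 - q 0 = x20 at *
  generalize p 2 - q 1 = x21 at *
  generalize p 2 - q 2 = x22 at *
  field_simp at Y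
  norm_num at Y

/-- PL maps are continuous. -/
lemma IsPLMap.continuousOn {f : ℝ → ℝ × ℝ} {a b : ℝ} (h : IsPLMap f a b) :
    ContinuousOn f (Set.Icc a b) := by
  obtain ⟨k, t, hk, rfl, rfl, ht, hf⟩ := h
  clear hk
  have : ∀ n ≤ k, t 0 ≤ t n ∧ ContinuousOn f (Set.Icc (t 0) (t n)) := by
    intro n
    induction n with
    | zero => intro _; simp
    | succ n ih =>
      intro hn
      obtain ⟨h1, h2⟩ := ih (by omega)
      have h3 := ht n (by omega)
      refine ⟨by linarith, ?_⟩
      rw [← Set.Icc_union_Icc_eq_Icc h1 h3.le]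
      refine h2.union_of_isClosed ?_ isClosed_Icc isClosed_Icc
      obtain ⟨u, v, -, huv⟩ := hf n (by omega)
      exact ContinuousOn.congr (by fun_prop) huv
  exact (this k le_rfl).2

/-- There is no PL `K₃,₃`-configuration in the plane. -/
theorem no_pl_K33_configuration :
    ¬ ∃ (U V : Finset (ℝ × ℝ)) (F : ℝ × ℝ → ℝ × ℝ → ℝ → ℝ × ℝ),
      U.card = 3 ∧ V.card = 3 ∧ Disjoint U V ∧
      (∀ u ∈ U, ∀ v ∈ V, IsPLArc01 (F u v) ∧ F u v 0 = u ∧ F u v 1 = v) ∧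
      (∀ u ∈ U, ∀ v ∈ V, ∀ u' ∈ U, ∀ v' ∈ V, (u, v) ≠ (u', v') →
        (F u v '' Set.Ioo 0 1) ∩ (F u' v' '' Set.Ioo 0 1) = ∅) ∧
      (∀ u ∈ U, ∀ v ∈ V,
        (F u v '' Set.Ioo 0 1) ∩ (↑U ∪ ↑V : Set (ℝ × ℝ)) = ∅) := by
  rintro ⟨U, V, F, hU, hV, hUV, hF, hint, hav⟩
  let eU := U.equivFinOfCardEq hU
  let eV := V.equivFinOfCardEq hV
  let P : Fin 3 → ℝ × ℝ := fun i => (eU.symm i : ℝ × ℝ)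
  let Q : Fin 3 → ℝ × ℝ := fun i => (eV.symm i : ℝ × ℝ)
  have hP : ∀ i, P i ∈ U := fun i => (eU.symm i).2
  have hQ : ∀ i, Q i ∈ V := fun i => (eV.symm i).2
  have Pinj : ∀ i k, i ≠ k → P i ≠ P k := fun i k h h' => h (eU.symm.injective (Subtype.ext h'))
  have Qinj : ∀ i k, i ≠ k → Q i ≠ Q k := fun i k h h' => h (eV.symm.injective (Subtype.ext h'))
  have PQ : ∀ i k, P i ≠ Q k := fun i k h =>
    Finset.disjoint_left.1 hUV (hP i) (h ▸ hQ k)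
  let c : (ℝ × ℝ) ≃L[ℝ] ℂ := Complex.equivRealProdCLM.symm
  -- disjointness on the closed interval
  have cases : ∀ s ∈ Set.Icc (0 : ℝ) 1, s = 0 ∨ s = 1 ∨ s ∈ Set.Ioo (0 : ℝ) 1 := by
    rintro s ⟨h0, h1⟩
    rcases h0.eq_or_lt with h | h
    · exact Or.inl h.symm
    rcases h1.eq_or_lt with h' | h'
    · exact Or.inr (Or.inl h')
    · exact Or.inr (Or.inr ⟨h, h'⟩)
  have z : ∀ i j, F (P i) (Q j) 0 = P i := fun i j => (hF _ (hP i) _ (hQ j)).2.1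
  have o : ∀ i j, F (P i) (Q j) 1 = Q j := fun i j => (hF _ (hP i) _ (hQ j)).2.2
  have avP : ∀ i j k, ∀ s ∈ Set.Ioo (0 : ℝ) 1, F (P i) (Q j) s ≠ P k := by
    intro i j k s hs h
    have : P k ∈ (F (P i) (Q j) '' Set.Ioo 0 1) ∩ (↑U ∪ ↑V : Set (ℝ × ℝ)) :=
      ⟨⟨s, hs, h⟩, Or.inl (hP k)⟩
    rw [hav _ (hP i) _ (hQ j)] at this
    exact this
  have avQ : ∀ i j k, ∀ s ∈ Set.Ioo (0 : ℝ) 1, F (P i) (Q j) s ≠ Q k := by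
    intro i j k s hs h
    have : Q k ∈ (F (P i) (Q j) '' Set.Ioo 0 1) ∩ (↑U ∪ ↑V : Set (ℝ × ℝ)) :=
      ⟨⟨s, hs, h⟩, Or.inr (hQ k)⟩
    rw [hav _ (hP i) _ (hQ j)] at this
    exact this
  have dis : ∀ i j k l, i ≠ k → j ≠ l → ∀ s ∈ Set.Icc (0 : ℝ) 1, ∀ t ∈ Set.Icc (0 : ℝ) 1,
      F (P i) (Q j) s ≠ F (P k) (Q l) t := by
    intro i j k l hik hjl s hs t ht
    rcases cases s hs with rfl | rfl | hs' <;> rcases cases t ht with rfl | rfl | ht'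
    · rw [z, z]; exact Pinj _ _ hik
    · rw [z, o]; exact PQ _ _
    · rw [z]; exact (avP _ _ _ _ ht').symm
    · rw [z, o]; exact (PQ _ _).symm
    · rw [o, o]; exact Qinj _ _ hjl
    · rw [o]; exact (avQ _ _ _ _ ht').symm
    · rw [z]; exact avP _ _ _ _ hs'
    · rw [o]; exact avQ _ _ _ _ hs'
    · intro h
      have : F (P i) (Q j) s ∈
          (F (P i) (Q j) '' Set.Ioo 0 1) ∩ (F (P k) (Q l) '' Set.Ioo 0 1) :=
        ⟨⟨s, hs', rfl⟩, ⟨t, ht', h.symm⟩⟩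
      rw [hint _ (hP i) _ (hQ j) _ (hP k) _ (hQ l)
        (fun h => Pinj _ _ hik (Prod.ext_iff.1 h).1)] at this
      exact this
  let pr : ℝ → ℝ := fun s => (Set.projIcc (0 : ℝ) 1 zero_le_one s : ℝ)
  have hpr : ∀ s, pr s ∈ Set.Icc (0 : ℝ) 1 := fun s => (Set.projIcc (0 : ℝ) 1 zero_le_one s).2
  have hprc : Continuous pr := continuous_subtype_val.comp continuous_projIcc
  have pr0 : pr 0 = 0 := by simp [pr]
  have pr1 : pr 1 = 1 := by simp [pr]
  refine no_cont_K33 (fun i => c (P i)) (fun j => c (Q j))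
    (fun i j s => c (F (P i) (Q j) (pr s))) ?_ ?_ ?_ ?_
  · intro i j
    exact c.continuous.comp
      ((hF _ (hP i) _ (hQ j)).1.1.continuousOn.comp_continuous hprc hpr)
  · intro i j; simp only [pr0, z]
  · intro i j; simp only [pr1, o]
  · intro i j k l hik hjl s t h
    exact dis i j k l hik hjl _ (hpr s) _ (hpr t) (c.injective h)
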